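/- arXiv:2604.27515 — 2 statements merged into one kernel-verified Lean document; each statement's English description precedes it below -/
import Mathlib

section
/- Let P be a convex polytope with ℓ nonconstant on edges such that O^- is a stratification. Then for every vertex v of P, dim F^+(v) + dim F^-(v) = dim P. -/
open Set

variable {V : Type*} [NormedAddCommGroup V] [NormedSpace ℝ V]

/-- A (nonempty) convex polytope: the convex hull of a nonempty finite set of points. -/
def IsPolytope (P : Set V) : Prop :=
  ∃ s : Finset V, s.Nonempty ∧ P = convexHull ℝ (s : Set V)

/-- A (nonempty exposed) face of a polytope. -/
def IsFace (P F : Set V) : Prop :=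
  F.Nonempty ∧ IsExposed ℝ P F

/-- A vertex of a polytope: a point whose singleton is a face. -/
def IsVertex (P : Set V) (v : V) : Prop := IsFace P {v}

/-- An edge of a polytope: a face which is a nondegenerate segment. -/
def IsEdge (P : Set V) (v w : V) : Prop := v ≠ w ∧ IsFace P (segment ℝ v w)

/-- `ℓ` attains its maximum on `G` at `v`. -/
def MaxAt (ℓ : V →L[ℝ] ℝ) (G : Set V) (v : V) : Prop := v ∈ G ∧ ∀ x ∈ G, ℓ x ≤ ℓ v

/-- `ℓ` attains its minimum on `G` at `v`. -/
def MinAt (ℓ : V →L[ℝ] ℝ) (G : Set V) (v : V) : Prop := v ∈ G ∧ ∀ x ∈ G, ℓ v ≤ ℓ x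

/-- `ℓ` is nonconstant on every edge of `P`. -/
def NonconstOnEdges (P : Set V) (ℓ : V →L[ℝ] ℝ) : Prop :=
  ∀ v w, IsEdge P v w → ℓ v ≠ ℓ w

/-- Directed edge: an edge oriented by increasing `ℓ`. -/
def DirEdge (P : Set V) (ℓ : V →L[ℝ] ℝ) (v w : V) : Prop := IsEdge P v w ∧ ℓ v < ℓ w

/-- The witness relation `O(v,w)`: some face of `P` has ℓ-minimum at `v` and
ℓ-maximum at `w`. -/
def ORel (P : Set V) (ℓ : V →L[ℝ] ℝ) (v w : V) : Prop :=
  ∃ G, IsFace P G ∧ MinAt ℓ G v ∧ MaxAt ℓ G w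

/-- `O⁻(v)`: the union of relative interiors of faces of `P` on which `ℓ` attains
its maximum at `v`. -/
def Oneg (P : Set V) (ℓ : V →L[ℝ] ℝ) (v : V) : Set V :=
  ⋃ G ∈ {G : Set V | IsFace P G ∧ MaxAt ℓ G v}, intrinsicInterior ℝ G

/-- `O⁺(v)`: the union of relative interiors of faces of `P` on which `ℓ` attains
its minimum at `v`. -/
def Opos (P : Set V) (ℓ : V →L[ℝ] ℝ) (v : V) : Set V :=
  ⋃ G ∈ {G : Set V | IsFace P G ∧ MinAt ℓ G v}, intrinsicInterior ℝ G

/-- `F⁻(v)`: the closure of `O⁻(v)`. -/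
def Fneg (P : Set V) (ℓ : V →L[ℝ] ℝ) (v : V) : Set V := closure (Oneg P ℓ v)

/-- `F⁺(v)`: the closure of `O⁺(v)`. -/
def Fpos (P : Set V) (ℓ : V →L[ℝ] ℝ) (v : V) : Set V := closure (Opos P ℓ v)

/-- The partition `O⁻` is a stratification. -/
def StratNeg (P : Set V) (ℓ : V →L[ℝ] ℝ) : Prop :=
  ∀ u w : V, IsVertex P u → IsVertex P w →
    (Oneg P ℓ u ∩ Fneg P ℓ w).Nonempty → Oneg P ℓ u ⊆ Fneg P ℓ w

/-- The dimension of a subset of `V` (dimension of its affine span). -/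
noncomputable def dimS (F : Set V) : ℕ := Module.finrank ℝ (vectorSpan ℝ F)

/-- The dimension of `F⁻(v)`: the maximal dimension of a face of `P` with
ℓ-maximum at `v`. -/
noncomputable def dimFneg (P : Set V) (ℓ : V →L[ℝ] ℝ) (v : V) : ℕ :=
  sSup {d : ℕ | ∃ G, IsFace P G ∧ MaxAt ℓ G v ∧ dimS G = d}

/-- The dimension of `F⁺(v)`: the maximal dimension of a face of `P` with
ℓ-minimum at `v`. -/
noncomputable def dimFpos (P : Set V) (ℓ : V →L[ℝ] ℝ) (v : V) : ℕ :=
  sSup {d : ℕ | ∃ G, IsFace P G ∧ MinAt ℓ G v ∧ dimS G = d}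

lemma exists_fun_sep (U : Submodule ℝ V) [FiniteDimensional ℝ U] {x : V} (hx : x ∉ U) :
    ∃ n : V →L[ℝ] ℝ, (∀ u ∈ U, n u = 0) ∧ n x ≠ 0 := by
  have : IsClosed (U : Set V) := U.closed_of_finiteDimensional
  have h : U.mkQL x ≠ 0 := by
    simpa using hx
  obtain ⟨f, hf⟩ := SeparatingDual.exists_ne_zero (R := ℝ) h
  refine ⟨f.comp U.mkQL, fun u hu => ?_, hf⟩
  have : U.mkQL u = 0 := by simpa using hu
  simp [this]

lemma relint_aux (A : Set V) (hA : Convex ℝ A) (hne : A.Nonempty)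
    [FiniteDimensional ℝ (vectorSpan ℝ A)] :
    A ⊆ closure (intrinsicInterior ℝ A) ∧
    ∃ x ∈ intrinsicInterior ℝ A, ∀ y ∈ A, ∃ ε > (0:ℝ), x + ε • (x - y) ∈ A := by
  obtain ⟨a, ha⟩ := hne
  let W := vectorSpan ℝ A
  let φ : W →ᵃⁱ[ℝ] V :=
    (AffineIsometryEquiv.vaddConst ℝ a).toAffineIsometry.comp W.subtypeₗᵢ.toAffineIsometry
  have hφ : ∀ w : W, φ w = (w : V) + a := fun w => rfl
  let A' : Set W := φ ⁻¹' A
  have himg : φ '' A' = A := by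
    apply Set.image_preimage_eq_of_subset
    intro x hx
    exact ⟨⟨x - a, vsub_mem_vectorSpan ℝ hx ha⟩, by simp [hφ]⟩
  have hA' : Convex ℝ A' := hA.affine_preimage φ.toAffineMap
  have ha' : (0 : W) ∈ A' := by simpa [A', hφ] using ha
  have hvs : vectorSpan ℝ A' = ⊤ := by
    have h1 := AffineMap.map_vectorSpan φ.toAffineMap (s := A')
    have h2 : (φ.toAffineMap : W → V) '' A' = A := himg
    rw [h2] at h1
    have h3 : φ.toAffineMap.linear = W.subtype := by
      rfl
    rw [h3] at h1
    apply Submodule.map_injective_of_injective W.injective_subtype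
    rw [h1, Submodule.map_top, Submodule.range_subtype]
  have hint : (interior A').Nonempty := by
    rw [hA'.interior_nonempty_iff_affineSpan_eq_top,
      AffineSubspace.affineSpan_eq_top_iff_vectorSpan_eq_top_of_nonempty ℝ W W ⟨0, ha'⟩]
    exact hvs
  have hsub : φ '' interior A' ⊆ intrinsicInterior ℝ A := by
    rw [← himg, φ.intrinsicInterior_image]
    exact Set.image_mono interior_subset_intrinsicInterior
  constructor
  · intro x hx
    rw [← himg] at hx
    obtain ⟨w, hw, rfl⟩ := hx
    have : w ∈ closure (interior A') := by
      rw [hA'.closure_interior_eq_closure_of_nonempty_interior hint]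
      exact subset_closure hw
    exact closure_mono hsub (image_closure_subset_closure_image φ.continuous ⟨w, this, rfl⟩)
  · obtain ⟨w, hw⟩ := hint
    refine ⟨φ w, hsub ⟨w, hw, rfl⟩, fun y hy => ?_⟩
    rw [← himg] at hy
    obtain ⟨z, hz, rfl⟩ := hy
    have hc : Filter.Tendsto (fun t : ℝ => w + t • (w - z)) (nhdsWithin 0 (Set.Ioi 0)) (nhds w) := by
      have : Continuous (fun t : ℝ => w + t • (w - z)) := by fun_prop
      have := (this.tendsto 0).mono_left (nhdsWithin_le_nhds (s := Set.Ioi 0))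
      simpa using this
    have h1 := hc.eventually (mem_interior_iff_mem_nhds.1 hw)
    obtain ⟨t, ht, ht0⟩ := (h1.and self_mem_nhdsWithin).exists
    refine ⟨t, ht0, ?_⟩
    have : φ (w + t • (w - z)) ∈ A := ht
    rw [hφ] at this
    convert this using 1
    simp [hφ]
    abel

lemma move_aux {ι : Type*} (S : Finset ι) (a b : ι → ℝ) (ha : ∀ i ∈ S, 0 ≤ a i)
    (hb : ∀ i ∈ S, a i = 0 → b i = 0) (hne : ∃ i ∈ S, b i ≠ 0) :
    ∃ t : ℝ, (∀ i ∈ S, 0 ≤ a i + t * b i) ∧ ∃ i ∈ S, a i ≠ 0 ∧ a i + t * b i = 0 := by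
  classical
  let S' := S.filter (fun i => b i ≠ 0)
  have hS' : S'.Nonempty := by
    obtain ⟨i, hi, hi'⟩ := hne
    exact ⟨i, by simp [S', hi, hi']⟩
  -- minimize a/|b|
  obtain ⟨j, hj, hmin⟩ := Finset.exists_min_image S' (fun i => a i / |b i|) hS'
  simp only [S', Finset.mem_filter] at hj hmin
  have hbj : 0 < |b j| := abs_pos.2 hj.2
  have hj0 : a j ≠ 0 := fun h => hj.2 (hb j hj.1 h)
  have hr : 0 ≤ a j / |b j| := div_nonneg (ha j hj.1) hbj.le
  have key : ∀ σ : ℝ, |σ| = 1 → ∀ i ∈ S, 0 ≤ a i + (σ * (a j / |b j|)) * b i := by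
    intro σ hσ i hi
    by_cases h : b i = 0
    · simp [h, ha i hi]
    · have h1 := hmin i ⟨hi, h⟩
      have h2 : a j / |b j| * |b i| ≤ a i := by
        rwa [le_div_iff₀ (abs_pos.2 h)] at h1
      have h3 : |(σ * (a j / |b j|)) * b i| = a j / |b j| * |b i| := by
        rw [abs_mul, abs_mul, hσ, one_mul, abs_of_nonneg hr]
      have := neg_abs_le ((σ * (a j / |b j|)) * b i)
      linarith
  rcases lt_or_gt_of_ne hj.2 with h | h
  · refine ⟨1 * (a j / |b j|), key 1 (by simp), j, hj.1, hj0, ?_⟩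
    have h5 := hj.2
    rw [abs_of_neg h, div_neg]; field_simp; ring
  · refine ⟨(-1) * (a j / |b j|), key (-1) (by simp), j, hj.1, hj0, ?_⟩
    have h5 := hj.2
    rw [abs_of_pos h]; field_simp; ring

lemma big_aux {ι : Type*} (S : Finset ι) (a b : ι → ℝ) (hb : ∀ i ∈ S, 0 ≤ b i)
    (hab : ∀ i ∈ S, b i = 0 → 0 ≤ a i) :
    ∃ T : ℝ, 0 ≤ T ∧ ∀ i ∈ S, 0 ≤ a i + T * b i ∧ (a i + T * b i = 0 → b i = 0) := by
  have hnn : ∀ i ∈ S, 0 ≤ (|a i| + 1) / b i := fun i hi =>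
    div_nonneg (by positivity) (hb i hi)
  refine ⟨∑ i ∈ S, (|a i| + 1) / b i, Finset.sum_nonneg hnn, fun i hi => ?_⟩
  by_cases h : b i = 0
  · simp [h, hab i hi h]
  · have hpos : 0 < b i := lt_of_le_of_ne (hb i hi) (Ne.symm h)
    have h1 : (|a i| + 1) / b i ≤ ∑ i ∈ S, (|a i| + 1) / b i :=
      Finset.single_le_sum hnn hi
    have h2 : |a i| + 1 ≤ (∑ i ∈ S, (|a i| + 1) / b i) * b i := by
      rwa [div_le_iff₀ hpos] at h1
    have h3 := neg_abs_le (a i)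
    constructor
    · linarith
    · intro h4; linarith

lemma max_nat_aux {α : Type*} (p : α → Prop) (f : α → ℕ) (N : ℕ) (hb : ∀ a, p a → f a ≤ N)
    (h : ∃ a, p a) : ∃ a, p a ∧ ∀ b, p b → f b ≤ f a := by
  have hbdd : BddAbove {d | ∃ a, p a ∧ f a = d} := ⟨N, by rintro d ⟨a, ha, rfl⟩; exact hb a ha⟩
  obtain ⟨a, ha⟩ := h
  obtain ⟨c, hc, hc'⟩ := Nat.sSup_mem (s := {d | ∃ a, p a ∧ f a = d}) ⟨f a, a, ha, rfl⟩ hbdd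
  exact ⟨c, hc, fun b hb' => hc' ▸ le_csSup hbdd ⟨b, hb', rfl⟩⟩

lemma face_of_le {P : Set V} (m : V →L[ℝ] ℝ) (M : ℝ) (h : ∀ x ∈ P, m x ≤ M) {v : V} (hv : v ∈ P)
    (hvM : m v = M) : IsFace P {x ∈ P | m x = M} := by
  refine ⟨⟨v, hv, hvM⟩, fun _ => ⟨m, ?_⟩⟩
  ext x
  constructor
  · rintro ⟨hx, hxM⟩
    exact ⟨hx, fun y hy => hxM ▸ h y hy⟩
  · rintro ⟨hx, hxM⟩
    exact ⟨hx, le_antisymm (h x hx) (hvM ▸ hxM v hv)⟩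

lemma face_elim {P F : Set V} (h : IsFace P F) :
    ∃ (m : V →L[ℝ] ℝ) (M : ℝ), (∀ x ∈ P, m x ≤ M) ∧ F = {x ∈ P | m x = M} := by
  obtain ⟨m, hm⟩ := h.2 h.1
  obtain ⟨v, hv⟩ := h.1
  have hv' := hv
  rw [hm] at hv'
  refine ⟨m, m v, hv'.2, ?_⟩
  rw [hm]
  ext x
  constructor
  · rintro ⟨hx, hxM⟩
    exact ⟨hx, le_antisymm (hv'.2 x hx) (hxM v hv'.1)⟩
  · rintro ⟨hx, hxM⟩
    exact ⟨hx, fun y hy => (hv'.2 y hy).trans hxM.ge⟩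

lemma face_subset {P F : Set V} (h : IsFace P F) : F ⊆ P := h.2.subset

lemma hull_le {s : Set V} (m : V →L[ℝ] ℝ) (M : ℝ) (h : ∀ x ∈ s, m x ≤ M) :
    ∀ x ∈ convexHull ℝ s, m x ≤ M := by
  have hc : Convex ℝ {x | m x ≤ M} := convex_halfSpace_le m.toLinearMap.isLinear M
  exact fun x hx => convexHull_min (t := {x | m x ≤ M}) h hc hx

open Classical in
lemma hull_face (s : Finset V) (m : V →L[ℝ] ℝ) (M : ℝ) (h : ∀ x ∈ s, m x ≤ M) :
    {x ∈ convexHull ℝ (s : Set V) | m x = M} =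
      convexHull ℝ ((s.filter (fun x => m x = M) : Finset V) : Set V) := by
  ext x
  constructor
  · rintro ⟨hx, hxM⟩
    rw [Finset.mem_convexHull'] at hx ⊢
    obtain ⟨w, hw0, hw1, rfl⟩ := hx
    have hsum : ∑ y ∈ s, w y * (M - m y) = 0 := by
      simp only [map_sum, map_smul, smul_eq_mul] at hxM
      simp only [mul_sub, Finset.sum_sub_distrib, ← Finset.sum_mul, hw1, hxM]
      ring
    have hz := (Finset.sum_eq_zero_iff_of_nonneg
      (fun y hy => mul_nonneg (hw0 y hy) (sub_nonneg.2 (h y hy)))).1 hsum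
    have hz' : ∀ y ∈ s, m y ≠ M → w y = 0 := by
      intro y hy hne
      rcases mul_eq_zero.1 (hz y hy) with h1 | h1
      · exact h1
      · exact absurd (by linarith) hne
    refine ⟨w, fun y hy => hw0 y (Finset.mem_filter.1 hy).1, ?_, ?_⟩
    · rw [← hw1]
      apply Finset.sum_filter_of_ne
      intro y hy h1
      by_contra h2
      exact h1 (hz' y hy h2)
    · apply Finset.sum_filter_of_ne
      intro y hy h1
      by_contra h2
      exact h1 (by rw [hz' y hy h2, zero_smul])
  · intro hx
    have hsub : ((s.filter (fun x => m x = M) : Finset V) : Set V) ⊆ s := by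
      intro y hy; exact (Finset.mem_filter.1 hy).1
    refine ⟨convexHull_mono hsub hx, le_antisymm ?_ ?_⟩
    · exact hull_le m M (fun y hy => (Finset.mem_filter.1 hy).2.le) x hx
    · have := hull_le (-m) (-M) (fun y hy => by
        have := (Finset.mem_filter.1 hy).2; simp [this]) x hx
      simpa using this

lemma face_polytope {P F : Set V} (hP : IsPolytope P) (h : IsFace P F) : IsPolytope F := by
  classical
  obtain ⟨s, hs, rfl⟩ := hP
  obtain ⟨m, M, hm, hF⟩ := face_elim h
  rw [hull_face s m M (fun x hx => hm x (subset_convexHull ℝ _ hx))] at hF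
  refine ⟨_, ?_, hF⟩
  have := h.1
  rw [hF, convexHull_nonempty_iff] at this
  exact_mod_cast this

lemma faces_finite {P : Set V} (hP : IsPolytope P) : {F | IsFace P F}.Finite := by
  classical
  obtain ⟨s, hs, rfl⟩ := hP
  apply Set.Finite.subset
    (s := (fun t : Finset V => convexHull ℝ (t : Set V)) '' (s.powerset : Set (Finset V)))
  · exact (Finset.finite_toSet _).image _
  · intro F h
    obtain ⟨m, M, hm, hF⟩ := face_elim h
    rw [hull_face s m M (fun x hx => hm x (subset_convexHull ℝ _ hx))] at hF
    exact ⟨_, Finset.mem_coe.2 (Finset.mem_powerset.2 (Finset.filter_subset _ _)), hF.symm⟩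

lemma poly_convex {P : Set V} (hP : IsPolytope P) : Convex ℝ P := by
  obtain ⟨s, hs, rfl⟩ := hP
  exact convex_convexHull ℝ _

lemma poly_closed {P : Set V} (hP : IsPolytope P) : IsClosed P := by
  obtain ⟨s, hs, rfl⟩ := hP
  exact s.finite_toSet.isClosed_convexHull ℝ

lemma poly_nonempty {P : Set V} (hP : IsPolytope P) : P.Nonempty := by
  obtain ⟨s, hs, rfl⟩ := hP
  rw [convexHull_nonempty_iff]; exact_mod_cast hs

lemma poly_vs (s : Set V) : vectorSpan ℝ (convexHull ℝ s) = vectorSpan ℝ s := by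
  rw [← direction_affineSpan, affineSpan_convexHull, direction_affineSpan]

lemma poly_fd {P : Set V} (hP : IsPolytope P) : FiniteDimensional ℝ (vectorSpan ℝ P) := by
  obtain ⟨s, hs, rfl⟩ := hP
  rw [poly_vs]
  exact finiteDimensional_vectorSpan_of_finite ℝ s.finite_toSet

lemma poly_max {P : Set V} (hP : IsPolytope P) (f : V →L[ℝ] ℝ) :
    ∃ M, (∀ x ∈ P, f x ≤ M) ∧ ∃ x ∈ P, f x = M := by
  obtain ⟨s, hs, rfl⟩ := hP
  obtain ⟨x, hx, hmax⟩ := Finset.exists_max_image s f hs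
  exact ⟨f x, hull_le f _ hmax, x, subset_convexHull ℝ _ hx, rfl⟩

lemma face_refl {P : Set V} (h : P.Nonempty) : IsFace P P := ⟨h, IsExposed.refl P⟩

lemma face_trans {P G H : Set V} (hP : IsPolytope P) (hG : IsFace P G) (hH : IsFace G H) :
    IsFace P H := by
  classical
  obtain ⟨s, hs, rfl⟩ := hP
  obtain ⟨g, M, hg, hGe⟩ := face_elim hG
  obtain ⟨h, N, hh, hHe⟩ := face_elim hH
  have hsP : ∀ x ∈ s, x ∈ convexHull ℝ (s : Set V) := fun x hx => subset_convexHull ℝ _ hx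
  obtain ⟨T, hT, hT'⟩ := big_aux s (fun x => N - h x) (fun x => M - g x)
    (fun x hx => sub_nonneg.2 (hg x (hsP x hx)))
    (fun x hx h0 => sub_nonneg.2 (hh x (by rw [hGe]; exact ⟨hsP x hx, by linarith⟩)))
  have hle : ∀ x ∈ s, (T • g + h) x ≤ T * M + N := by
    intro x hx
    have := (hT' x hx).1
    simp only [add_apply, smul_apply, smul_eq_mul]
    nlinarith
  have hHH : H = {x ∈ convexHull ℝ (s : Set V) | (T • g + h) x = T * M + N} := by
    apply Set.Subset.antisymm
    · intro x hx
      rw [hHe] at hx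
      obtain ⟨hx, hxN⟩ := hx
      rw [hGe] at hx
      refine ⟨hx.1, ?_⟩
      simp [hx.2, hxN]
    · rw [hull_face s _ _ hle]
      apply convexHull_min
      · intro x hx
        obtain ⟨hx, hx'⟩ := Finset.mem_filter.1 hx
        simp only [add_apply, smul_apply,
          smul_eq_mul] at hx'
        have h1 := (hT' x hx).2 (by linarith)
        have h2 : g x = M := by linarith
        rw [h2] at hx'
        rw [hHe]
        exact ⟨by rw [hGe]; exact ⟨hsP x hx, h2⟩, by linarith⟩
      · exact poly_convex (face_polytope (face_polytope ⟨s, hs, rfl⟩ hG) hH)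
  obtain ⟨y, hy⟩ := hH.1
  rw [hHH]
  rw [hHH] at hy
  exact face_of_le _ _ (hull_le _ _ hle) hy.1 hy.2

lemma vertex_mono {P G : Set V} {v : V} (hG : G ⊆ P) (hv : IsVertex P v) (hvG : v ∈ G) :
    IsVertex G v := ⟨hv.1, hv.2.mono hG (by simpa using hvG)⟩

lemma dim_mono {A B : Set V} (hB : IsPolytope B) (h : A ⊆ B) : dimS A ≤ dimS B := by
  have := poly_fd hB
  exact Submodule.finrank_mono (vectorSpan_mono ℝ h)

lemma dim_strict {P A B : Set V} (hB : IsPolytope B) (hBP : B ⊆ P) (hA : IsFace P A) (h : A ⊆ B)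
    {w : V} (hw : w ∈ B) (hwA : w ∉ A) : dimS A < dimS B := by
  have := poly_fd hB
  apply Submodule.finrank_lt_finrank_of_lt
  refine lt_of_le_of_ne (vectorSpan_mono ℝ h) fun heq => hwA ?_
  obtain ⟨m, M, hm, hAe⟩ := face_elim hA
  obtain ⟨a, ha⟩ := hA.1
  have h1 : vectorSpan ℝ A ≤ LinearMap.ker m.toLinearMap := by
    rw [vectorSpan_def, Submodule.span_le]
    rintro _ ⟨x, hx, y, hy, rfl⟩
    rw [hAe] at hx hy
    simp [hx.2, hy.2]
  rw [heq] at h1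
  have h2 := h1 (vsub_mem_vectorSpan ℝ hw (h ha))
  simp at h2
  rw [hAe] at ha ⊢
  exact ⟨hBP hw, by rw [← ha.2]; linarith⟩

lemma exists_vertex : ∀ (n : ℕ) (Q : Set V), IsPolytope Q → dimS Q ≤ n → ∃ v, IsVertex Q v := by
  intro n
  induction n using Nat.strong_induction_on with
  | _ n ih =>
  intro Q hQ hn
  by_cases hsub : Q.Subsingleton
  · obtain ⟨v, hv⟩ := poly_nonempty hQ
    have : Q = {v} := hsub.eq_singleton_of_mem hv
    refine ⟨v, ?_⟩
    unfold IsVertex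
    rw [← this]
    exact face_refl ⟨v, hv⟩
  · rw [Set.not_subsingleton_iff] at hsub
    obtain ⟨x, hx, y, hy, hxy⟩ := hsub
    obtain ⟨f, hf⟩ := SeparatingDual.exists_separating_of_ne (R := ℝ) hxy
    obtain ⟨M, hM, z, hz, hzM⟩ := poly_max hQ f
    have hF := face_of_le f M hM hz hzM
    have hex : ∃ w ∈ Q, w ∉ {x ∈ Q | f x = M} := by
      by_contra hcon
      push Not at hcon
      exact hf ((hcon x hx).2.trans (hcon y hy).2.symm)
    obtain ⟨w, hw, hw'⟩ := hex
    have hlt := dim_strict hQ subset_rfl hF (face_subset hF) hw hw'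
    obtain ⟨v, hv⟩ := ih _ (lt_of_lt_of_le hlt hn) _ (face_polytope hQ hF) le_rfl
    exact ⟨v, face_trans hQ hF hv⟩

lemma vertex_mem {P : Set V} {v : V} (hv : IsVertex P v) : v ∈ P := face_subset hv rfl

lemma vertex_fun {P : Set V} {v : V} (hv : IsVertex P v) :
    ∃ m : V →L[ℝ] ℝ, (∀ x ∈ P, 0 ≤ m (x - v)) ∧ ∀ x ∈ P, m (x - v) = 0 → x = v := by
  obtain ⟨m, M, hm, he⟩ := face_elim hv
  have hvv : v ∈ {x ∈ P | m x = M} := by rw [← he]; rfl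
  refine ⟨-m, fun x hx => ?_, fun x hx h => ?_⟩
  · have := hm x hx
    simp [hvv.2]; linarith
  · simp [hvv.2] at h
    have : x ∈ ({v} : Set V) := by rw [he]; exact ⟨hx, by linarith⟩
    exact this

lemma exists_max_vertex {P G : Set V} (hP : IsPolytope P) (hG : IsFace P G) (ℓ : V →L[ℝ] ℝ) :
    ∃ w, IsVertex P w ∧ MaxAt ℓ G w := by
  have hGp := face_polytope hP hG
  obtain ⟨M, hM, z, hz, hzM⟩ := poly_max hGp ℓ
  have hF := face_of_le ℓ M hM hz hzM
  obtain ⟨w, hw⟩ := exists_vertex _ _ (face_polytope hGp hF) le_rfl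
  have hwF := vertex_mem hw
  exact ⟨w, face_trans hP hG (face_trans hGp hF hw), hwF.1, fun x hx => hwF.2 ▸ hM x hx⟩

lemma vs_le_of {s : Set V} {v : V} (U : Submodule ℝ V) (h : ∀ x ∈ s, x - v ∈ U) :
    vectorSpan ℝ (convexHull ℝ s) ≤ U := by
  rw [poly_vs, vectorSpan_def, Submodule.span_le]
  rintro _ ⟨x, hx, y, hy, rfl⟩
  have := U.sub_mem (h x hx) (h y hy)
  simpa using this

/-- A facet through the vertex `v` avoiding `w`. -/
lemma facet_aux {Q : Set V} (hQ : IsPolytope Q) {v w : V} (hv : IsVertex Q v) (hw : w ∈ Q)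
    (hvw : w ≠ v) : ∃ G, IsFace Q G ∧ v ∈ G ∧ w ∉ G ∧
      vectorSpan ℝ Q ≤ vectorSpan ℝ G ⊔ Submodule.span ℝ {w - v} := by
  classical
  have hvQ := vertex_mem hv
  obtain ⟨m0, hm0, hm0'⟩ := vertex_fun hv
  obtain ⟨s, hs, hQs⟩ := id hQ
  have hsQ : ∀ x ∈ s, x ∈ Q := fun x hx => by rw [hQs]; exact subset_convexHull ℝ _ hx
  obtain ⟨m, ⟨hm1, hm2⟩, hmax⟩ := max_nat_aux
    (fun m : V →L[ℝ] ℝ => (∀ x ∈ s, 0 ≤ m (x - v)) ∧ 0 < m (w - v))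
    (fun m => (s.filter (fun x => m (x - v) = 0)).card) s.card
    (fun m _ => Finset.card_filter_le _ _)
    ⟨m0, fun x hx => hm0 x (hsQ x hx), lt_of_le_of_ne (hm0 w hw)
      (fun h => hvw (hm0' w hw h.symm))⟩
  have hle : ∀ x ∈ Q, (-m) x ≤ (-m) v := by
    rw [hQs]
    apply hull_le
    intro x hx
    have := hm1 x hx
    simp at this ⊢
    exact this
  have hG := face_of_le (-m) _ hle hvQ rfl
  have hGm : ∀ x ∈ Q, x ∈ {x ∈ Q | (-m) x = (-m) v} ↔ m (x - v) = 0 := by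
    intro x hx
    simp [hx, sub_eq_zero]
  refine ⟨_, hG, ⟨hvQ, rfl⟩, fun h => ?_, ?_⟩
  · rw [hGm w hw] at h
    exact hm2.ne' h
  · set G := {x ∈ Q | (-m) x = (-m) v} with hGdef
    by_contra hcon
    have hex : ∃ x ∈ s, x - v ∉ vectorSpan ℝ G ⊔ Submodule.span ℝ {w - v} := by
      by_contra h
      push Not at h
      apply hcon
      rw [hQs]
      exact vs_le_of _ h
    obtain ⟨x, hx, hxU⟩ := hex
    have := poly_fd (face_polytope hQ hG)
    obtain ⟨n, hn, hnx⟩ := exists_fun_sep _ hxU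
    have hnw : n (w - v) = 0 :=
      hn _ (Submodule.mem_sup_right (Submodule.mem_span_singleton_self _))
    have hnG : ∀ y ∈ s, m (y - v) = 0 → n (y - v) = 0 := by
      intro y hy h
      apply hn
      apply Submodule.mem_sup_left
      exact vsub_mem_vectorSpan ℝ ((hGm y (hsQ y hy)).2 h) ⟨hvQ, rfl⟩
    obtain ⟨t, ht, j, hj, hj1, hj2⟩ := move_aux s (fun y => m (y - v)) (fun y => n (y - v)) hm1 hnG
      ⟨x, hx, hnx⟩
    have h1 := hmax (m + t • n) ⟨fun y hy => by simpa using ht y hy, by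
      rw [add_apply, smul_apply, hnw, smul_zero, add_zero]; exact hm2⟩
    refine absurd h1 (not_le.2 (Finset.card_lt_card ?_))
    rw [Finset.ssubset_iff_of_subset]
    · refine ⟨j, Finset.mem_filter.2 ⟨hj, ?_⟩, fun h => hj1 (Finset.mem_filter.1 h).2⟩
      rw [add_apply, smul_apply, smul_eq_mul]; exact hj2
    · intro y hy
      obtain ⟨hy, hy'⟩ := Finset.mem_filter.1 hy
      refine Finset.mem_filter.2 ⟨hy, ?_⟩
      rw [add_apply, smul_apply, hnG y hy hy', hy']; simp

lemma dim_facet {Q G : Set V} {z : V} (hQ : IsPolytope Q) (hG : IsFace Q G)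
    (h : vectorSpan ℝ Q ≤ vectorSpan ℝ G ⊔ Submodule.span ℝ {z}) : dimS Q ≤ dimS G + 1 := by
  have := poly_fd (face_polytope hQ hG)
  have h1 := Submodule.finrank_mono h
  have h2 := Submodule.finrank_add_le_finrank_add_finrank (vectorSpan ℝ G) (Submodule.span ℝ {z})
  have h3 : Module.finrank ℝ (Submodule.span ℝ {z}) ≤ 1 := by
    have := finrank_span_le_card (R := ℝ) ({z} : Set V)
    simpa using this
  unfold dimS
  omega

lemma exists_edge : ∀ (n : ℕ) (Q : Set V), IsPolytope Q → dimS Q ≤ n → ¬ Q.Subsingleton →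
    ∃ v w, IsEdge Q v w := by
  intro n
  induction n using Nat.strong_induction_on with
  | _ n ih =>
  intro Q hQ hn hns
  obtain ⟨v, hv⟩ := exists_vertex _ Q hQ le_rfl
  have hvQ := vertex_mem hv
  obtain ⟨m, hm, hm'⟩ := vertex_fun hv
  obtain ⟨M, hM, w, hw, hwM⟩ := poly_max hQ m
  have hwv : w ≠ v := by
    rintro rfl
    apply hns
    have : ∀ x ∈ Q, x = w := fun x hx => hm' x hx (le_antisymm (by
      have := hM x hx; simp; linarith) (hm x hx))
    intro x hx y hy
    rw [this x hx, this y hy]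
  obtain ⟨G, hG, hvG, hwG, hspan⟩ := facet_aux hQ hv hw hwv
  by_cases hGs : G.Subsingleton
  · have hGv : G = {v} := hGs.eq_singleton_of_mem hvG
    rw [hGv, vectorSpan_singleton, bot_sup_eq] at hspan
    refine ⟨v, w, hwv.symm, ?_⟩
    have hQe : segment ℝ v w = Q := by
      apply Set.Subset.antisymm
      · exact (poly_convex hQ).segment_subset hvQ hw
      · intro x hx
        obtain ⟨c, hc⟩ := Submodule.mem_span_singleton.1 (hspan (vsub_mem_vectorSpan ℝ hx hvQ))
        have hpos : 0 < m (w - v) := lt_of_le_of_ne (hm w hw) fun h => hwv (hm' w hw h.symm)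
        have h1 : m (x - v) = c * m (w - v) := by
          have := congrArg m hc
          simpa using this.symm
        have h2 := hm x hx
        have h3 : m (x - v) ≤ m (w - v) := by
          have := hM x hx; simp; linarith
        have hc0 : 0 ≤ c := by
          by_contra h; push Not at h; nlinarith
        have hc1 : c ≤ 1 := by
          by_contra h; push Not at h; nlinarith
        rw [segment_eq_image']
        refine ⟨c, ⟨hc0, hc1⟩, ?_⟩
        simp only [hc, vsub_eq_sub]; abel
    rw [hQe]
    exact face_refl ⟨v, hvQ⟩
  · have hlt := dim_strict hQ subset_rfl hG (face_subset hG) hw hwG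
    obtain ⟨a, b, hab, hab'⟩ := ih _ (lt_of_lt_of_le hlt hn) G (face_polytope hQ hG) le_rfl hGs
    exact ⟨a, b, hab, face_trans hQ hG hab'⟩

lemma const_face {P G : Set V} (hP : IsPolytope P) {ℓ : V →L[ℝ] ℝ} (hℓ : NonconstOnEdges P ℓ)
    (hG : IsFace P G) {c : ℝ} (hc : ∀ x ∈ G, ℓ x = c) : G.Subsingleton := by
  by_contra h
  obtain ⟨a, b, hab, hab'⟩ := exists_edge _ G (face_polytope hP hG) le_rfl h
  have h1 := face_subset hab'
  exact hℓ a b ⟨hab, face_trans hP hG hab'⟩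
    ((hc a (h1 (left_mem_segment ℝ a b))).trans (hc b (h1 (right_mem_segment ℝ a b))).symm)

lemma strat_aux {P : Set V} (hP : IsPolytope P) {ℓ : V →L[ℝ] ℝ} (hstrat : StratNeg P ℓ)
    {u w : V} (hu : IsVertex P u) (hw : IsVertex P w) {H A : Set V} (hH : IsFace P H)
    (hHw : MaxAt ℓ H w) (huH : u ∈ H) (hA : IsFace P A) (hAu : MaxAt ℓ A u) :
    ∃ B, IsFace P B ∧ MaxAt ℓ B w ∧ A ⊆ B := by
  have hHp := face_polytope hP hH
  have hAp := face_polytope hP hA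
  have := poly_fd hHp
  have := poly_fd hAp
  have h1 : u ∈ Oneg P ℓ u := by
    simp only [Oneg, Set.mem_iUnion]
    refine ⟨{u}, ⟨hu, rfl, ?_⟩, by simp⟩
    rintro x rfl; exact le_rfl
  have h2 : u ∈ Fneg P ℓ w := by
    refine closure_mono ?_ ((relint_aux H (poly_convex hHp) hH.1).1 huH)
    intro x hx
    simp only [Oneg, Set.mem_iUnion]
    exact ⟨H, ⟨hH, hHw⟩, hx⟩
  have h3 := hstrat u w hu hw ⟨u, h1, h2⟩
  obtain ⟨x, hx, hxA⟩ := (relint_aux A (poly_convex hAp) hA.1).2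
  have h4 : x ∈ Fneg P ℓ w := by
    apply h3
    simp only [Oneg, Set.mem_iUnion]
    exact ⟨A, ⟨hA, hAu⟩, hx⟩
  have hcl : IsClosed (⋃ G ∈ {G : Set V | IsFace P G ∧ MaxAt ℓ G w}, G) := by
    apply Set.Finite.isClosed_biUnion
    · exact (faces_finite hP).subset fun G hG => hG.1
    · intro G hG
      exact poly_closed (face_polytope hP hG.1)
  have h5 : x ∈ ⋃ G ∈ {G : Set V | IsFace P G ∧ MaxAt ℓ G w}, G := by
    refine closure_minimal ?_ hcl h4
    exact Set.iUnion₂_mono fun G _ => intrinsicInterior_subset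
  simp only [Set.mem_iUnion] at h5
  obtain ⟨B, ⟨hB, hBw⟩, hxB⟩ := h5
  refine ⟨B, hB, hBw, fun y hy => ?_⟩
  obtain ⟨m, M, hm, hBe⟩ := face_elim hB
  rw [hBe] at hxB ⊢
  obtain ⟨ε, hε, hy'⟩ := hxA y hy
  have h6 := hm _ (face_subset hA hy')
  have h7 := hm y (face_subset hA hy)
  refine ⟨face_subset hA hy, le_antisymm h7 ?_⟩
  simp [hxB.2] at h6
  by_contra h
  push Not at h
  nlinarith [mul_pos hε (sub_pos.2 h)]

lemma neg_bdd {P : Set V} (hP : IsPolytope P) (ℓ : V →L[ℝ] ℝ) (v : V) :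
    BddAbove {d : ℕ | ∃ G, IsFace P G ∧ MaxAt ℓ G v ∧ dimS G = d} :=
  ⟨dimS P, by rintro d ⟨G, hG, -, rfl⟩; exact dim_mono hP (face_subset hG)⟩

lemma pos_bdd {P : Set V} (hP : IsPolytope P) (ℓ : V →L[ℝ] ℝ) (v : V) :
    BddAbove {d : ℕ | ∃ G, IsFace P G ∧ MinAt ℓ G v ∧ dimS G = d} :=
  ⟨dimS P, by rintro d ⟨G, hG, -, rfl⟩; exact dim_mono hP (face_subset hG)⟩

lemma neg_attain {P : Set V} (hP : IsPolytope P) (ℓ : V →L[ℝ] ℝ) {v : V} (hv : IsVertex P v) :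
    ∃ G, IsFace P G ∧ MaxAt ℓ G v ∧ dimS G = dimFneg P ℓ v :=
  Nat.sSup_mem (s := {d : ℕ | ∃ G, IsFace P G ∧ MaxAt ℓ G v ∧ dimS G = d})
    ⟨_, {v}, hv, ⟨rfl, by rintro x rfl; exact le_rfl⟩, rfl⟩ (neg_bdd hP ℓ v)

lemma pos_attain {P : Set V} (hP : IsPolytope P) (ℓ : V →L[ℝ] ℝ) {v : V} (hv : IsVertex P v) :
    ∃ G, IsFace P G ∧ MinAt ℓ G v ∧ dimS G = dimFpos P ℓ v :=
  Nat.sSup_mem (s := {d : ℕ | ∃ G, IsFace P G ∧ MinAt ℓ G v ∧ dimS G = d})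
    ⟨_, {v}, hv, ⟨rfl, by rintro x rfl; exact le_rfl⟩, rfl⟩ (pos_bdd hP ℓ v)

lemma step_aux {P : Set V} (hP : IsPolytope P) {ℓ : V →L[ℝ] ℝ} (hstrat : StratNeg P ℓ)
    {u w : V} (hu : IsVertex P u) (hw : IsVertex P w) {H : Set V} (hH : IsFace P H)
    (hHw : MaxAt ℓ H w) (huH : u ∈ H) (hlt : ℓ u < ℓ w) :
    dimFneg P ℓ u + 1 ≤ dimFneg P ℓ w := by
  obtain ⟨A, hA, hAu, hAd⟩ := neg_attain hP ℓ hu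
  obtain ⟨B, hB, hBw, hAB⟩ := strat_aux hP hstrat hu hw hH hHw huH hA hAu
  have h1 := dim_strict (face_polytope hP hB) (face_subset hB) hA hAB hBw.1
    (fun h => absurd (hAu.2 w h) (not_le.2 hlt))
  have h2 : dimS B ≤ dimFneg P ℓ w := le_csSup (neg_bdd hP ℓ w) ⟨B, hB, hBw, rfl⟩
  omega

lemma upper_aux {P : Set V} (hP : IsPolytope P) {ℓ : V →L[ℝ] ℝ} (hℓ : NonconstOnEdges P ℓ)
    (hstrat : StratNeg P ℓ) {v : V} (hv : IsVertex P v) :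
    ∀ (n : ℕ) (G : Set V) (w : V), IsFace P G → dimS G ≤ n → IsVertex P w → MinAt ℓ G v →
      MaxAt ℓ G w → dimFneg P ℓ v + dimS G ≤ dimFneg P ℓ w := by
  intro n
  induction n using Nat.strong_induction_on with
  | _ n ih =>
  intro G w hG hn hw hmin hmax
  have hGp := face_polytope hP hG
  by_cases hvw : w = v
  · subst hvw
    have hs : G.Subsingleton :=
      const_face hP hℓ hG (c := ℓ w) fun x hx => le_antisymm (hmax.2 x hx) (hmin.2 x hx)
    have h0 : dimS G = 0 := by
      unfold dimS
      rw [hs.eq_singleton_of_mem hmin.1, vectorSpan_singleton]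
      simp
    omega
  · obtain ⟨G', hG', hvG', hwG', hspan⟩ :=
      facet_aux hGp (vertex_mono (face_subset hG) hv hmin.1) hmax.1 hvw
    have hd := dim_facet hGp hG' hspan
    have hlt := dim_strict hGp subset_rfl hG' (face_subset hG') hmax.1 hwG'
    have hG'P := face_trans hP hG hG'
    obtain ⟨w', hw', hmax'⟩ := exists_max_vertex hP hG'P ℓ
    have h1 := ih _ (lt_of_lt_of_le hlt hn) G' w' hG'P le_rfl hw'
      ⟨hvG', fun x hx => hmin.2 x (face_subset hG' hx)⟩ hmax'
    have hw'G := face_subset hG' hmax'.1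
    have hlt' : ℓ w' < ℓ w := by
      refine lt_of_le_of_ne (hmax.2 w' hw'G) fun heq => ?_
      have hF := face_of_le ℓ (ℓ w) hmax.2 hmax.1 rfl
      have hs := const_face hP hℓ (face_trans hP hG hF) (c := ℓ w) fun x hx => hx.2
      have : w' = w := hs ⟨hw'G, heq⟩ ⟨hmax.1, rfl⟩
      exact hwG' (this ▸ hmax'.1)
    have h2 := step_aux hP hstrat hw' hw hG hmax hw'G hlt'
    omega

lemma lower_aux {P : Set V} (hP : IsPolytope P) (ℓ : V →L[ℝ] ℝ) {v : V} (hv : IsVertex P v) :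
    dimS P ≤ dimFpos P ℓ v + dimFneg P ℓ v := by
  classical
  have hvP := vertex_mem hv
  obtain ⟨m0, hm0, hm0'⟩ := vertex_fun hv
  obtain ⟨s, hs, hPs⟩ := id hP
  have hsP : ∀ x ∈ s, x ∈ P := fun x hx => by rw [hPs]; exact subset_convexHull ℝ _ hx
  obtain ⟨T, hT0, hT⟩ := big_aux s (fun x => ℓ (x - v)) (fun x => m0 (x - v))
    (fun x hx => hm0 x (hsP x hx)) (fun x hx h => by rw [hm0' x (hsP x hx) h]; simp)
  obtain ⟨m, ⟨hmℓ, hm1⟩, hmax⟩ := max_nat_aux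
    (fun m : Bool → V →L[ℝ] ℝ => m true - m false = ℓ ∧
      ∀ p ∈ s ×ˢ (Finset.univ : Finset Bool), 0 ≤ m p.2 (p.1 - v))
    (fun m => ((s ×ˢ (Finset.univ : Finset Bool)).filter (fun p => m p.2 (p.1 - v) = 0)).card)
    (s ×ˢ (Finset.univ : Finset Bool)).card
    (fun m _ => Finset.card_filter_le _ _)
    ⟨fun c => if c then ℓ + T • m0 else T • m0, by simp, by
      rintro ⟨x, c⟩ hp
      have hx : x ∈ s := (Finset.mem_product.1 hp).1
      cases c
      · have := mul_nonneg hT0 (hm0 x (hsP x hx))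
        simpa using this
      · have := (hT x hx).1
        simpa using this⟩
  have hmem : ∀ x ∈ s, ∀ c : Bool, (x, c) ∈ s ×ˢ (Finset.univ : Finset Bool) := fun x hx c =>
    Finset.mem_product.2 ⟨hx, Finset.mem_univ _⟩
  have hle : ∀ c, ∀ x ∈ P, (-(m c)) x ≤ (-(m c)) v := by
    intro c
    rw [hPs]
    apply hull_le
    intro x hx
    have := hm1 (x, c) (hmem x hx c)
    simp at this ⊢
    exact this
  have hG := fun c => face_of_le (-(m c)) _ (hle c) hvP rfl
  set G : Bool → Set V := fun c => {x ∈ P | (-(m c)) x = (-(m c)) v} with hGdef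
  have hGm : ∀ c, ∀ x ∈ P, x ∈ G c ↔ m c (x - v) = 0 := by
    intro c x hx
    simp [hGdef, hx, sub_eq_zero]
  have hvG : ∀ c, v ∈ G c := fun c => ⟨hvP, rfl⟩
  have hℓe : ∀ x, ℓ x = m true x - m false x := fun x => by rw [← hmℓ]; rfl
  have hfd : ∀ c, FiniteDimensional ℝ (vectorSpan ℝ (G c)) := fun c =>
    poly_fd (face_polytope hP (hG c))
  have h1 : dimS (G true) ≤ dimFneg P ℓ v := by
    refine le_csSup (neg_bdd hP ℓ v) ⟨_, hG true, ⟨hvG true, fun x hx => ?_⟩, rfl⟩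
    have h2 := hx.2
    have h3 := hle false x hx.1
    rw [hℓe, hℓe]
    simp at h2 h3
    linarith
  have h2 : dimS (G false) ≤ dimFpos P ℓ v := by
    refine le_csSup (pos_bdd hP ℓ v) ⟨_, hG false, ⟨hvG false, fun x hx => ?_⟩, rfl⟩
    have h2 := hx.2
    have h3 := hle true x hx.1
    rw [hℓe, hℓe]
    simp at h2 h3
    linarith
  have hspan : vectorSpan ℝ P ≤ vectorSpan ℝ (G true) ⊔ vectorSpan ℝ (G false) := by
    by_contra hcon
    have hex : ∃ x ∈ s, x - v ∉ vectorSpan ℝ (G true) ⊔ vectorSpan ℝ (G false) := by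
      by_contra h
      push Not at h
      apply hcon
      rw [hPs]
      exact vs_le_of _ h
    obtain ⟨x, hx, hxU⟩ := hex
    obtain ⟨n, hn, hnx⟩ := exists_fun_sep _ hxU
    have hnG : ∀ p ∈ s ×ˢ (Finset.univ : Finset Bool), m p.2 (p.1 - v) = 0 → n (p.1 - v) = 0 := by
      rintro ⟨y, c⟩ hp h
      have hy : y ∈ s := (Finset.mem_product.1 hp).1
      have h5 : y - v ∈ vectorSpan ℝ (G c) :=
        vsub_mem_vectorSpan ℝ ((hGm c y (hsP y hy)).2 h) (hvG c)
      apply hn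
      cases c
      · exact Submodule.mem_sup_right h5
      · exact Submodule.mem_sup_left h5
    obtain ⟨t, ht, j, hj, hj1, hj2⟩ := move_aux (s ×ˢ (Finset.univ : Finset Bool))
      (fun p => m p.2 (p.1 - v)) (fun p => n (p.1 - v)) hm1 hnG ⟨(x, true), hmem x hx _, hnx⟩
    have h1 := hmax (fun c => m c + t • n) ⟨by rw [← hmℓ]; abel, fun y hy => by
      simpa using ht y hy⟩
    refine absurd h1 (not_le.2 (Finset.card_lt_card ?_))
    rw [Finset.ssubset_iff_of_subset]
    · refine ⟨j, Finset.mem_filter.2 ⟨hj, ?_⟩, fun h => hj1 (Finset.mem_filter.1 h).2⟩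
      rw [add_apply, smul_apply, smul_eq_mul]; exact hj2
    · intro y hy
      obtain ⟨hy, hy'⟩ := Finset.mem_filter.1 hy
      refine Finset.mem_filter.2 ⟨hy, ?_⟩
      rw [add_apply, smul_apply, hnG y hy hy', hy']; simp
  have := hfd true
  have := hfd false
  have h3 := Submodule.finrank_mono hspan
  have h4 := Submodule.finrank_add_le_finrank_add_finrank
    (vectorSpan ℝ (G true)) (vectorSpan ℝ (G false))
  unfold dimS at h1 h2 ⊢
  omega

/-- If `O⁻` is a stratification, then for every vertex `v` of `P`,
`dim F⁺(v) + dim F⁻(v) = dim P`. -/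
theorem stmt14 (P : Set V) (hP : IsPolytope P) (ℓ : V →L[ℝ] ℝ)
    (hℓ : NonconstOnEdges P ℓ) (hstrat : StratNeg P ℓ)
    (v : V) (hv : IsVertex P v) :
    dimFpos P ℓ v + dimFneg P ℓ v = dimS P := by
  apply le_antisymm
  · obtain ⟨G, hG, hGv, hGd⟩ := pos_attain hP ℓ hv
    obtain ⟨w, hw, hmax⟩ := exists_max_vertex hP hG ℓ
    have h1 := upper_aux hP hℓ hstrat hv _ G w hG le_rfl hw hGv hmax
    obtain ⟨A, hA, -, hAd⟩ := neg_attain hP ℓ hw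
    have h2 := dim_mono hP (face_subset hA)
    omega
  · exact lower_aux hP ℓ hv
end

section
/- Let n ≥ 5 and let P be a convex n-gon in the plane with a linear functional ℓ nonconstant on every edge. Then the partition O^- of P is never a stratification. -/
open Set

variable {V : Type*} [NormedAddCommGroup V] [NormedSpace ℝ V]

abbrev E2 := EuclideanSpace ℝ (Fin 2)

theorem exists_x (ℓ : E2 →L[ℝ] ℝ) (d : E2) (h : ℓ d ≠ 0) :
    ∃ x : E2 →L[ℝ] ℝ, x d = 0 ∧ ∀ f : E2 →L[ℝ] ℝ, ∃ α β : ℝ, ∀ z, f z = α * ℓ z + β * x z := by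
  have key : ∀ f : E2 →L[ℝ] ℝ, ∃ p q : ℝ, ∀ z : E2, f z = p * z 0 + q * z 1 := by
    intro f
    refine ⟨f (EuclideanSpace.single 0 1), f (EuclideanSpace.single 1 1), fun z => ?_⟩
    have hz : z = z 0 • EuclideanSpace.single (0 : Fin 2) (1 : ℝ)
        + z 1 • EuclideanSpace.single (1 : Fin 2) (1 : ℝ) := by
      ext i; fin_cases i <;> simp
    conv_lhs => rw [hz]
    simp only [map_add, map_smul, smul_eq_mul]; ring
  obtain ⟨p, q, hpq⟩ := key ℓ
  refine ⟨d 0 • EuclideanSpace.proj (1 : Fin 2) - d 1 • EuclideanSpace.proj (0 : Fin 2), ?_, ?_⟩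
  · simp; ring
  · intro f
    obtain ⟨a, b, hab⟩ := key f
    rw [hpq] at h
    refine ⟨(a * d 0 + b * d 1) / (p * d 0 + q * d 1), (p * b - q * a) / (p * d 0 + q * d 1),
      fun z => ?_⟩
    rw [hab, hpq]
    simp only [_root_.sub_apply, _root_.smul_apply, smul_eq_mul,
      EuclideanSpace.coe_proj]
    rw [div_mul_eq_mul_div, div_mul_eq_mul_div, ← add_div, eq_div_iff h]
    ring

theorem inj_of_span {ℓ x : E2 →L[ℝ] ℝ}
    (h : ∀ f : E2 →L[ℝ] ℝ, ∃ α β : ℝ, ∀ z, f z = α * ℓ z + β * x z) {a b : E2}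
    (h1 : ℓ a = ℓ b) (h2 : x a = x b) : a = b := by
  ext i
  obtain ⟨α, β, hf⟩ := h (EuclideanSpace.proj i)
  have ha := hf a
  have hb := hf b
  rw [h1, h2, ← hb] at ha
  simpa using ha

theorem face_sub {P G C : Set E2} (hc : IsCompact P) (hv : Convex ℝ P) (hG : IsExposed ℝ P G)
    (hC : Convex ℝ C) (hC' : IsClosed C) (h : ∀ w ∈ P.extremePoints ℝ, w ∈ G → w ∈ C) : G ⊆ C := by
  have h1 := closure_convexHull_extremePoints (hG.isCompact hc) (hG.convex hv)
  rw [← h1]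
  refine closure_minimal (convexHull_min ?_ hC) hC'
  intro w hw
  exact h w (hG.isExtreme.extremePoints_subset_extremePoints hw) hw.1

theorem seg_face {P : Set E2} (hc : IsCompact P) (hv : Convex ℝ P) {a b : E2} (ha : a ∈ P)
    (hb : b ∈ P) (f : E2 →L[ℝ] ℝ) (hab : f a = f b)
    (h : ∀ w ∈ P.extremePoints ℝ, w = a ∨ w = b ∨ f w < f a) : IsFace P (segment ℝ a b) := by
  have hle : P ⊆ {z | f z ≤ f a} := by
    refine face_sub hc hv (IsExposed.refl P) (convex_halfSpace_le f.isLinear _)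
      (isClosed_le f.continuous continuous_const) ?_
    intro w hw _
    rcases h w hw with rfl | rfl | h'
    · exact le_refl (f w)
    · exact hab.ge
    · exact h'.le
  have hGe : IsExposed ℝ P {z ∈ P | ∀ y ∈ P, f y ≤ f z} := fun _ => ⟨f, rfl⟩
  refine ⟨⟨a, left_mem_segment ℝ a b⟩, ?_⟩
  have : segment ℝ a b = {z ∈ P | ∀ y ∈ P, f y ≤ f z} := by
    apply Subset.antisymm
    · refine (hGe.convex hv).segment_subset ⟨ha, fun y hy => hle hy⟩ ⟨hb, fun y hy => ?_⟩
      rw [← hab]; exact hle hy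
    · refine face_sub hc hv hGe (convex_segment a b) ?_ ?_
      · rw [← convexHull_pair]
        exact (Set.Finite.isCompact_convexHull ℝ (Set.toFinite {a, b})).isClosed
      · intro w hw hwG
        rcases h w hw with rfl | rfl | h'
        · exact left_mem_segment ℝ _ _
        · exact right_mem_segment ℝ _ _
        · exact absurd (hwG.2 a ha) (not_le.2 h')
  rw [this]; exact hGe

theorem vertex_iff {P : Set E2} (hP : IsPolytope P) (v : E2) :
    IsVertex P v ↔ v ∈ P.extremePoints ℝ := by
  constructor
  · intro h
    exact isExtreme_singleton.1 h.2.isExtreme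
  · intro h
    obtain ⟨s, hs, rfl⟩ := hP
    have hfin : (s : Set E2).Finite := s.finite_toSet
    have hc := Set.Finite.isCompact_convexHull ℝ hfin
    have h2 := ((convex_convexHull ℝ (s : Set E2)).mem_extremePoints_iff_convex_sdiff).1 h
    have h3 : v ∉ convexHull ℝ ((s : Set E2) \ {v}) := by
      intro hm
      have : convexHull ℝ ((s : Set E2) \ {v}) ⊆ convexHull ℝ (s : Set E2) \ {v} :=
        convexHull_min (fun y hy => ⟨subset_convexHull ℝ _ hy.1, hy.2⟩) h2.2
      exact (this hm).2 rfl
    obtain ⟨f, a, hf1, hf2⟩ := geometric_hahn_banach_closed_point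
      (convex_convexHull ℝ ((s : Set E2) \ {v}))
      (Set.Finite.isCompact_convexHull ℝ (hfin.sdiff)).isClosed h3
    unfold IsVertex
    rw [← segment_same ℝ v]
    refine seg_face hc (convex_convexHull ℝ _) h.1 h.1 f rfl ?_
    intro w hw
    by_cases hwv : w = v
    · exact Or.inl hwv
    · right; right
      exact (hf1 w (subset_convexHull ℝ _ ⟨extremePoints_convexHull_subset hw, hwv⟩)).trans hf2

theorem unique_max {P : Set E2} (hc : IsCompact P) (hv : Convex ℝ P) (hne : P.Nonempty)
    {ℓ : E2 →L[ℝ] ℝ} (h0 : ℓ ≠ 0) (hℓ : NonconstOnEdges P ℓ) :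
    ∃ t ∈ P, ∀ z ∈ P, ℓ z ≤ ℓ t ∧ (ℓ z = ℓ t → z = t) := by
  obtain ⟨d, hd⟩ : ∃ d, ℓ d ≠ 0 := by
    by_contra! h; exact h0 (ContinuousLinearMap.ext h)
  obtain ⟨x, -, hx⟩ := exists_x ℓ d hd
  obtain ⟨t, ht, htm⟩ := hc.exists_isMaxOn hne ℓ.continuous.continuousOn
  let F := {z ∈ P | ∀ y ∈ P, ℓ y ≤ ℓ z}
  have hF : IsExposed ℝ P F := fun _ => ⟨ℓ, rfl⟩
  have htF : t ∈ F := ⟨ht, fun y hy => htm hy⟩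
  have hFc := hF.isCompact hc
  obtain ⟨a, ha, ham⟩ := hFc.exists_isMinOn ⟨t, htF⟩ x.continuous.continuousOn
  obtain ⟨b, hb, hbm⟩ := hFc.exists_isMaxOn ⟨t, htF⟩ x.continuous.continuousOn
  have hℓF : ∀ z ∈ F, ∀ y ∈ F, ℓ z = ℓ y := fun z hz y hy => le_antisymm (hy.2 z hz.1) (hz.2 y hy.1)
  have ham' : ∀ z ∈ F, x a ≤ x z := fun z hz => ham hz
  have hbm' : ∀ z ∈ F, x z ≤ x b := fun z hz => hbm hz
  by_cases hab : a = b
  · refine ⟨t, ht, fun z hz => ⟨htm hz, fun he => ?_⟩⟩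
    have hzF : z ∈ F := ⟨hz, fun y hy => he ▸ htm hy⟩
    subst hab
    refine inj_of_span hx he ?_
    linarith [ham' z hzF, hbm' z hzF, ham' t htF, hbm' t htF]
  · exfalso
    have hxab : x a < x b := lt_of_le_of_ne (ham' b hb)
      (fun h => hab (inj_of_span hx (hℓF a ha b hb) h))
    have hseg : segment ℝ a b = F := by
      apply Subset.antisymm
      · exact (hF.convex hv).segment_subset ha hb
      · intro z hz
        have hpos : 0 < x b - x a := by linarith
        refine ⟨(x b - x z) / (x b - x a), (x z - x a) / (x b - x a),
          div_nonneg (by linarith [hbm' z hz]) hpos.le,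
          div_nonneg (by linarith [ham' z hz]) hpos.le, by field_simp; ring, ?_⟩
        apply inj_of_span hx
        · simp only [map_add, map_smul, smul_eq_mul]
          rw [hℓF a ha z hz, hℓF b hb z hz]; field_simp; ring
        · simp only [map_add, map_smul, smul_eq_mul]; field_simp; ring
    refine hℓ a b ⟨hab, ?_⟩ (hℓF a ha b hb)
    rw [hseg]
    exact ⟨⟨t, htF⟩, hF⟩

theorem seg_pt {C : Set E2} (hC : Convex ℝ C) (ℓ x : E2 →L[ℝ] ℝ) {a b : E2} (ha : a ∈ C)
    (hb : b ∈ C) {L : ℝ} (h1 : ℓ a ≤ L) (h2 : L ≤ ℓ b) (h : ℓ a < ℓ b) :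
    ∃ m ∈ C, ℓ m = L ∧ x m * (ℓ b - ℓ a) = x a * (ℓ b - L) + x b * (L - ℓ a) := by
  have hpos : 0 < ℓ b - ℓ a := by linarith
  refine ⟨((ℓ b - L) / (ℓ b - ℓ a)) • a + ((L - ℓ a) / (ℓ b - ℓ a)) • b,
    hC ha hb (div_nonneg (by linarith) hpos.le) (div_nonneg (by linarith) hpos.le)
      (by field_simp; ring), ?_, ?_⟩
  · simp only [map_add, map_smul, smul_eq_mul]; field_simp; ring
  · simp only [map_add, map_smul, smul_eq_mul]; field_simp

/-- the configuration -/
structure Cfg (P : Set E2) (ℓ x : E2 →L[ℝ] ℝ) (s t : E2) (c : ℝ) : Prop where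
  hc : IsCompact P
  hv : Convex ℝ P
  hs : s ∈ P
  ht : t ∈ P
  hx : ∀ f : E2 →L[ℝ] ℝ, ∃ α β : ℝ, ∀ z, f z = α * ℓ z + β * x z
  hmin : ∀ z ∈ P, ℓ s ≤ ℓ z ∧ (ℓ z = ℓ s → z = s)
  hmax : ∀ z ∈ P, ℓ z ≤ ℓ t ∧ (ℓ z = ℓ t → z = t)
  hst : ℓ s < ℓ t
  xs : x s = c
  xt : x t = c

theorem Q0 {P : Set E2} {ℓ x : E2 →L[ℝ] ℝ} {s t : E2} {c : ℝ} (H : Cfg P ℓ x s t c)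
    {q q' : E2} (hq : q ∈ P.extremePoints ℝ) (hqs : q ≠ s) (hqt : q ≠ t)
    (hq' : q' ∈ P \ {q}) (h1 : ℓ q' = ℓ q) (h2 : c ≤ x q) (h3 : x q ≤ x q') : False := by
  have hC := ((H.hv.mem_extremePoints_iff_convex_sdiff).1 hq).2
  obtain ⟨m, hm, hm1, hm2⟩ := seg_pt hC ℓ x (a := s) (b := t) ⟨H.hs, hqs.symm⟩ ⟨H.ht, hqt.symm⟩
    (H.hmin q hq.1).1 (H.hmax q hq.1).1 H.hst
  have hst := H.hst
  rw [H.xs, H.xt] at hm2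
  have hxm : x m = c := by
    have : (x m - c) * (ℓ t - ℓ s) = 0 := by linarith
    rcases mul_eq_zero.1 this with h | h <;> linarith
  rcases eq_or_lt_of_le (h2.trans h3) with h | h
  · have : m = q := inj_of_span H.hx hm1 (by linarith)
    exact hm.2 this
  · obtain ⟨r, hr, hr1, hr2⟩ := seg_pt hC x ℓ hm hq' (L := x q) (by linarith) h3 (by linarith)
    rw [hm1, h1] at hr2
    have : ℓ r = ℓ q := by
      have : (ℓ r - ℓ q) * (x q' - x m) = 0 := by linarith
      rcases mul_eq_zero.1 this with h | h <;> linarith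
    exact hr.2 (inj_of_span H.hx this hr1)

theorem Q1 {P : Set E2} {ℓ x : E2 →L[ℝ] ℝ} {s t : E2} {c : ℝ} (H : Cfg P ℓ x s t c)
    {q p r : E2} (hq : q ∈ P.extremePoints ℝ) (hp : p ∈ P) (hr : r ∈ P) (hpq : ℓ p < ℓ q)
    (hqr : ℓ q < ℓ r) (h2 : c ≤ x q) :
    x p * (ℓ r - ℓ q) + x r * (ℓ q - ℓ p) < x q * (ℓ r - ℓ p) := by
  by_contra! hcon
  have hC := ((H.hv.mem_extremePoints_iff_convex_sdiff).1 hq).2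
  obtain ⟨m, hm, hm1, hm2⟩ := seg_pt hC ℓ x (a := p) (b := r) (L := ℓ q)
    ⟨hp, by rintro rfl; exact lt_irrefl _ hpq⟩ ⟨hr, by rintro rfl; exact lt_irrefl _ hqr⟩
    hpq.le hqr.le (hpq.trans hqr)
  refine Q0 H hq ?_ ?_ hm hm1 h2 ?_
  · rintro rfl; linarith [(H.hmin p hp).1]
  · rintro rfl; linarith [(H.hmax r hr).1]
  · exact le_of_mul_le_mul_right (hcon.trans hm2.ge) (by linarith)

theorem core {P : Set E2} {ℓ x : E2 →L[ℝ] ℝ} {s t : E2} {c : ℝ} (H : Cfg P ℓ x s t c)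
    (hfin : {w ∈ P.extremePoints ℝ | c < x w}.Finite)
    (hcard : 2 ≤ {w ∈ P.extremePoints ℝ | c < x w}.ncard) :
    ∃ u ∈ P.extremePoints ℝ, ∃ v ∈ P.extremePoints ℝ, IsEdge P s u ∧ IsEdge P u v ∧
      ℓ s < ℓ u ∧ ℓ u < ℓ v ∧ ℓ v < ℓ t ∧
      ∀ f : E2 →L[ℝ] ℝ, f s = f u → f u = f v → f = 0 := by
  set T := {w ∈ P.extremePoints ℝ | c < x w} with hT
  have hTs : ∀ w ∈ T, w ≠ s := by
    rintro w hw rfl; exact absurd hw.2 (by rw [H.xs]; exact lt_irrefl _)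
  have hTt : ∀ w ∈ T, w ≠ t := by
    rintro w hw rfl; exact absurd hw.2 (by rw [H.xt]; exact lt_irrefl _)
  have hinj : ∀ a ∈ T, ∀ b ∈ T, ℓ a = ℓ b → a = b := by
    intro a ha b hb hab
    by_contra hne
    rcases le_total (x a) (x b) with h | h
    · exact Q0 H ha.1 (hTs a ha) (hTt a ha) ⟨hb.1.1, fun h => hne h.symm⟩ hab.symm ha.2.le h
    · exact Q0 H hb.1 (hTs b hb) (hTt b hb) ⟨ha.1.1, hne⟩ hab hb.2.le h
  obtain ⟨a0, ha0, b0, hb0, hab0⟩ := (Set.one_lt_ncard hfin).1 hcard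
  obtain ⟨u, hu, hum⟩ := Set.exists_min_image T ℓ hfin ⟨a0, ha0⟩
  have hne : (T \ {u}).Nonempty := by
    by_cases h : a0 = u
    · exact ⟨b0, hb0, fun h' => hab0 (h.trans h'.symm)⟩
    · exact ⟨a0, ha0, h⟩
  obtain ⟨v, hv, hvm⟩ := Set.exists_min_image (T \ {u}) ℓ hfin.sdiff hne
  have huv : ℓ u < ℓ v := lt_of_le_of_ne (hum v hv.1) (fun h => hv.2 (hinj u hu v hv.1 h).symm)
  have hsu : ℓ s < ℓ u := lt_of_le_of_ne (H.hmin u hu.1.1).1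
    (fun h => hTs u hu ((H.hmin u hu.1.1).2 h.symm))
  have hvt : ℓ v < ℓ t := lt_of_le_of_ne (H.hmax v hv.1.1.1).1
    (fun h => hTt v hv.1 ((H.hmax v hv.1.1.1).2 h))
  have hw : ∀ w ∈ P.extremePoints ℝ, x w ≤ c ∨ w = u ∨ w = v ∨ (ℓ v < ℓ w ∧ c < x w) := by
    intro w hw
    by_cases h1 : x w ≤ c
    · exact Or.inl h1
    have hwT : w ∈ T := ⟨hw, not_le.1 h1⟩
    by_cases h2 : w = u
    · exact Or.inr (Or.inl h2)
    by_cases h3 : w = v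
    · exact Or.inr (Or.inr (Or.inl h3))
    refine Or.inr (Or.inr (Or.inr ⟨lt_of_le_of_ne (hvm w ⟨hwT, h2⟩) ?_, hwT.2⟩))
    exact fun h => h3 (hinj v hv.1 w hwT h).symm
  have hxu : c < x u := hu.2
  have hxv : c < x v := hv.1.2
  have xs := H.xs
  have xt := H.xt
  have k1 := Q1 H hu.1 H.hs hv.1.1.1 hsu huv hxu.le
  have k2 := Q1 H hv.1.1 hu.1.1 H.ht huv hvt hxv.le
  rw [xs] at k1
  rw [xt] at k2
  refine ⟨u, hu.1, v, hv.1.1, ⟨fun h => by rw [h] at hsu; exact lt_irrefl _ hsu, ?_⟩,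
    ⟨fun h => by rw [h] at huv; exact lt_irrefl _ huv, ?_⟩, hsu, huv, hvt, ?_⟩
  · refine seg_face H.hc H.hv H.hs hu.1.1 ((ℓ u - ℓ s) • x - (x u - x s) • ℓ) ?_ ?_
    · simp; ring
    · intro w hwE
      simp only [_root_.sub_apply, _root_.smul_apply, smul_eq_mul]
      rcases hw w hwE with h | h | h | h
      · by_cases hws : w = s
        · exact Or.inl hws
        · right; right
          have : ℓ s < ℓ w := lt_of_le_of_ne (H.hmin w hwE.1).1
            (fun h => hws ((H.hmin w hwE.1).2 h.symm))
          rw [xs]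
          nlinarith [mul_pos (sub_pos.2 this) (sub_pos.2 hxu), mul_nonneg (sub_nonneg.2 h) (sub_pos.2 hsu).le]
      · exact Or.inr (Or.inl h)
      · right; right; subst h; rw [xs]; nlinarith
      · right; right
        have k := Q1 H hu.1 H.hs hwE.1 hsu (huv.trans h.1) hxu.le
        rw [xs] at k ⊢; nlinarith
  · refine seg_face H.hc H.hv hu.1.1 hv.1.1.1 ((ℓ v - ℓ u) • x - (x v - x u) • ℓ) ?_ ?_
    · simp; ring
    · intro w hwE
      simp only [_root_.sub_apply, _root_.smul_apply, smul_eq_mul]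
      rcases hw w hwE with h | h | h | h
      · right; right
        have b1 := (H.hmin w hwE.1).1
        have b2 := (H.hmax w hwE.1).1
        have hd : 0 < ℓ v - ℓ u := by linarith
        have g1 : (ℓ v - ℓ u) * c - (x v - x u) * ℓ w < (ℓ v - ℓ u) * x u - (x v - x u) * ℓ u := by
          rcases le_total 0 (x v - x u) with hs | hs
          · nlinarith [mul_nonneg hs (sub_nonneg.2 b1)]
          · nlinarith [mul_nonneg (neg_nonneg.2 hs) (sub_nonneg.2 b2)]
        nlinarith [mul_le_mul_of_nonneg_left h hd.le]
      · exact Or.inl h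
      · exact Or.inr (Or.inl h)
      · right; right
        have k := Q1 H hv.1.1 hu.1.1 hwE.1 huv h.1 hxv.le
        nlinarith
  · intro f h1 h2
    obtain ⟨α, β, hf⟩ := H.hx f
    rw [hf, hf] at h1 h2
    rw [xs] at h1
    have e1 : α * (ℓ u - ℓ s) + β * (x u - c) = 0 := by linarith
    have e2 : α * (ℓ v - ℓ s) + β * (x v - c) = 0 := by linarith
    have hD : (ℓ u - ℓ s) * (x v - c) - (ℓ v - ℓ s) * (x u - c) ≠ 0 := by
      apply ne_of_lt; nlinarith
    have hβ : β = 0 := by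
      have : β * ((ℓ u - ℓ s) * (x v - c) - (ℓ v - ℓ s) * (x u - c)) = 0 := by
        linear_combination (ℓ u - ℓ s) * e2 - (ℓ v - ℓ s) * e1
      exact (mul_eq_zero.1 this).resolve_right hD
    have hα : α = 0 := by
      rw [hβ] at e1
      have : α * (ℓ u - ℓ s) = 0 := by linarith
      exact (mul_eq_zero.1 this).resolve_right (by linarith)
    ext1 z
    simp [hf, hα, hβ]

theorem geom {P : Set E2} (hP : IsPolytope P) (hcard : 5 ≤ (P.extremePoints ℝ).ncard)
    {ℓ : E2 →L[ℝ] ℝ} (h0 : ℓ ≠ 0) (hℓ : NonconstOnEdges P ℓ) :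
    ∃ s t, t ∈ P ∧ ∃ u ∈ P.extremePoints ℝ, ∃ v ∈ P.extremePoints ℝ, IsEdge P s u ∧ IsEdge P u v ∧
      ℓ s < ℓ u ∧ ℓ u < ℓ v ∧ ℓ v < ℓ t ∧
      ∀ f : E2 →L[ℝ] ℝ, f s = f u → f u = f v → f = 0 := by
  have hfin : (P.extremePoints ℝ).Finite := Set.finite_of_ncard_pos (by omega)
  have hc : IsCompact P := by
    obtain ⟨s, hs, rfl⟩ := hP; exact Set.Finite.isCompact_convexHull ℝ s.finite_toSet
  have hv : Convex ℝ P := by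
    obtain ⟨s, hs, rfl⟩ := hP; exact convex_convexHull ℝ _
  have hEne : (P.extremePoints ℝ).Nonempty := Set.nonempty_of_ncard_ne_zero (by omega)
  have hne : P.Nonempty := hEne.mono extremePoints_subset
  obtain ⟨t, ht, hmax⟩ := unique_max hc hv hne h0 hℓ
  obtain ⟨s, hs, hmin⟩ := unique_max hc hv hne (ℓ := -ℓ) (neg_ne_zero.2 h0)
    (fun a b hab => by simpa using hℓ a b hab)
  have hmin' : ∀ z ∈ P, ℓ s ≤ ℓ z ∧ (ℓ z = ℓ s → z = s) := by
    intro z hz; have := hmin z hz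
    simpa using this
  have hst : ℓ s < ℓ t := by
    refine lt_of_le_of_ne (hmax s hs).1 (fun h => ?_)
    have : P.extremePoints ℝ ⊆ {t} := by
      intro w hw
      exact (hmax w hw.1).2 (le_antisymm (hmax w hw.1).1 (h ▸ (hmin' w hw.1).1))
    have := Set.ncard_le_ncard this
    rw [Set.ncard_singleton] at this
    omega
  obtain ⟨x, hxd, hx⟩ := exists_x ℓ (t - s) (by rw [map_sub]; linarith)
  have hxts : x t = x s := by rw [map_sub] at hxd; linarith
  have H : Cfg P ℓ x s t (x s) := ⟨hc, hv, hs, ht, hx, hmin', hmax, hst, rfl, hxts⟩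
  have H' : Cfg P ℓ (-x) s t (- x s) := ⟨hc, hv, hs, ht, fun f => by
      obtain ⟨α, β, h⟩ := hx f
      exact ⟨α, -β, fun z => by rw [h]; simp⟩, hmin', hmax, hst, rfl, by simp [hxts]⟩
  have hcov : P.extremePoints ℝ ⊆ ({s, t} ∪ {w ∈ P.extremePoints ℝ | x s < x w}) ∪
      {w ∈ P.extremePoints ℝ | - x s < (-x) w} := by
    intro w hw
    rcases lt_trichotomy (x w) (x s) with h | h | h
    · right; exact ⟨hw, by simpa using h⟩
    · left; left
      by_contra hcon
      simp only [mem_insert_iff, mem_singleton_iff, not_or] at hcon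
      have a1 : ℓ s < ℓ w := lt_of_le_of_ne (hmin' w hw.1).1
        (fun h => hcon.1 ((hmin' w hw.1).2 h.symm))
      have a2 : ℓ w < ℓ t := lt_of_le_of_ne (hmax w hw.1).1
        (fun h => hcon.2 ((hmax w hw.1).2 h))
      have := Q1 H hw hs ht a1 a2 h.ge
      rw [hxts, h] at this
      nlinarith
    · left; right; exact ⟨hw, h⟩
  have f1 : {w ∈ P.extremePoints ℝ | x s < x w}.Finite := hfin.subset (fun w hw => hw.1)
  have f2 : {w ∈ P.extremePoints ℝ | - x s < (-x) w}.Finite := hfin.subset (fun w hw => hw.1)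
  have c1 := Set.ncard_le_ncard hcov (((Set.toFinite {s, t}).union f1).union f2)
  have c2 := Set.ncard_union_le (({s, t} : Set E2) ∪ {w ∈ P.extremePoints ℝ | x s < x w})
    {w ∈ P.extremePoints ℝ | - x s < (-x) w}
  have c3 := Set.ncard_union_le ({s, t} : Set E2) {w ∈ P.extremePoints ℝ | x s < x w}
  have c4 : ({s, t} : Set E2).ncard ≤ 2 := by
    have := Set.ncard_insert_le s {t}
    rw [Set.ncard_singleton] at this; exact this
  by_cases h2 : 2 ≤ {w ∈ P.extremePoints ℝ | x s < x w}.ncard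
  · exact ⟨s, t, ht, core H f1 h2⟩
  · exact ⟨s, t, ht, core H' f2 (by omega)⟩

theorem seg_interior {a b : E2} (ℓ : E2 →L[ℝ] ℝ) (hab : ℓ a < ℓ b) {z : E2}
    (hz : z ∈ segment ℝ a b) (h1 : ℓ a < ℓ z) (h2 : ℓ z < ℓ b) :
    z ∈ intrinsicInterior ℝ (segment ℝ a b) := by
  have hzA : z ∈ affineSpan ℝ (segment ℝ a b) := subset_affineSpan ℝ _ hz
  rw [mem_intrinsicInterior]
  refine ⟨⟨z, hzA⟩, ?_, rfl⟩
  rw [mem_interior]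
  refine ⟨{y | ℓ a < ℓ (y : E2) ∧ ℓ (y : E2) < ℓ b}, ?_, ?_, ⟨h1, h2⟩⟩
  · rintro ⟨y, hy⟩ ⟨g1, g2⟩
    simp only [mem_preimage]
    have hy' : y ∈ line[ℝ, a, b] := by
      have : affineSpan ℝ (segment ℝ a b) = line[ℝ, a, b] := by
        rw [← convexHull_pair, affineSpan_convexHull]
      rwa [this] at hy
    obtain ⟨r, rfl⟩ := mem_affineSpan_pair_iff_exists_lineMap_eq.1 hy'
    simp only [AffineMap.lineMap_apply, vsub_eq_sub, vadd_eq_add, map_add, map_smul, map_sub,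
      smul_eq_mul] at g1 g2
    rw [segment_eq_image_lineMap]
    refine ⟨r, ⟨?_, ?_⟩, rfl⟩
    · by_contra! hr; nlinarith
    · by_contra! hr; nlinarith
  · exact (isOpen_lt continuous_const (ℓ.continuous.comp continuous_subtype_val)).inter
      (isOpen_lt (ℓ.continuous.comp continuous_subtype_val) continuous_const)

theorem edge_Oneg {P : Set E2} {ℓ : E2 →L[ℝ] ℝ} {a b : E2} (he : IsEdge P a b) (hab : ℓ a < ℓ b)
    {r : ℝ} (h0 : 0 < r) (h1 : r < 1) : AffineMap.lineMap a b r ∈ Oneg P ℓ b := by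
  have hz : AffineMap.lineMap a b r ∈ segment ℝ a b := by
    rw [segment_eq_image_lineMap]; exact ⟨r, ⟨h0.le, h1.le⟩, rfl⟩
  refine mem_biUnion (x := segment ℝ a b) ⟨he.2, right_mem_segment ℝ a b, ?_⟩ ?_
  · intro y hy
    exact (convex_halfSpace_le ℓ.isLinear (ℓ b)).segment_subset (x := a) (y := b)
      hab.le (le_refl (ℓ b)) hy
  · refine seg_interior ℓ hab hz ?_ ?_ <;>
    · simp only [AffineMap.lineMap_apply, vsub_eq_sub, vadd_eq_add, map_add, map_smul, map_sub,
        smul_eq_mul]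
      nlinarith

/-- For a convex n-gon in the plane with n ≥ 5 and `ℓ` nonconstant
on edges, the partition `O⁻` is never a stratification. -/
theorem stmt15 (n : ℕ) (hn : 5 ≤ n) (P : Set (EuclideanSpace ℝ (Fin 2)))
    (hP : IsPolytope P) (hdim : dimS P = 2)
    (hcard : {v | IsVertex P v}.ncard = n)
    (ℓ : EuclideanSpace ℝ (Fin 2) →L[ℝ] ℝ) (hℓ : NonconstOnEdges P ℓ) :
    ¬ StratNeg P ℓ := by
  have hEq : {v | IsVertex P v} = P.extremePoints ℝ := by
    ext v; exact vertex_iff hP v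
  rw [hEq] at hcard
  have h5 : 5 ≤ (P.extremePoints ℝ).ncard := by omega
  have hfin : (P.extremePoints ℝ).Finite := Set.finite_of_ncard_pos (by omega)
  have hc : IsCompact P := by
    obtain ⟨s, hs, rfl⟩ := hP; exact Set.Finite.isCompact_convexHull ℝ s.finite_toSet
  have hcv : Convex ℝ P := by
    obtain ⟨s, hs, rfl⟩ := hP; exact convex_convexHull ℝ _
  have h0 : ℓ ≠ 0 := by
    rintro rfl
    have hno : ∀ a b, ¬ IsEdge P a b := fun a b h => hℓ a b h (by simp)
    have hp : (EuclideanSpace.proj (0 : Fin 2) : E2 →L[ℝ] ℝ) ≠ 0 := by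
      intro h
      have := congrArg (fun g : E2 →L[ℝ] ℝ => g (EuclideanSpace.single 0 1)) h
      simp at this
    obtain ⟨s, t, -, u, -, v, -, he, -⟩ := geom hP h5 hp (fun a b h => absurd h (hno a b))
    exact hno _ _ he
  obtain ⟨s, t, ht, u, hu, v, hv, hsu, huv, lsu, luv, lvt, hf⟩ := geom hP h5 h0 hℓ
  intro hstrat
  have huO : u ∈ Oneg P ℓ u := by
    have huface : IsFace P {u} := (vertex_iff hP u).2 hu
    refine mem_biUnion (x := ({u} : Set E2)) ⟨huface, rfl, ?_⟩ ?_
    · rintro y rfl; exact le_rfl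
    · rw [intrinsicInterior_singleton]; rfl
  have huF : u ∈ Fneg P ℓ v := by
    have hcont : Continuous (fun r : ℝ => AffineMap.lineMap u v r) := AffineMap.lineMap_continuous
    have h1 : (0 : ℝ) ∈ closure (Ioo (0 : ℝ) 1) := by
      rw [closure_Ioo (by norm_num)]; simp
    have := map_mem_closure hcont h1 (t := Oneg P ℓ v)
      (fun r hr => edge_Oneg huv luv hr.1 hr.2)
    rw [AffineMap.lineMap_apply_zero] at this
    exact this
  have hsub := hstrat u v ((vertex_iff hP u).2 hu) ((vertex_iff hP v).2 hv) ⟨u, huO, huF⟩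
  have hm := hsub (edge_Oneg hsu lsu (r := 1 / 2) (by norm_num) (by norm_num))
  -- finitely many faces
  have hFf : {G : Set E2 | IsFace P G ∧ MaxAt ℓ G v}.Finite := by
    refine Set.Finite.of_finite_image (f := fun G => G.extremePoints ℝ)
      (hfin.finite_subsets.subset ?_) ?_
    · rintro _ ⟨G, hG, rfl⟩
      exact hG.1.2.isExtreme.extremePoints_subset_extremePoints
    · intro G hG G' hG' h
      rw [← closure_convexHull_extremePoints (hG.1.2.isCompact hc) (hG.1.2.convex hcv),
        ← closure_convexHull_extremePoints (hG'.1.2.isCompact hc) (hG'.1.2.convex hcv)]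
      simp only at h
      rw [h]
  have hclosed : IsClosed (⋃ G ∈ {G : Set E2 | IsFace P G ∧ MaxAt ℓ G v}, G) :=
    hFf.isClosed_biUnion (fun G hG => (hG.1.2.isCompact hc).isClosed)
  have hsub2 : Fneg P ℓ v ⊆ ⋃ G ∈ {G : Set E2 | IsFace P G ∧ MaxAt ℓ G v}, G :=
    closure_minimal (biUnion_mono subset_rfl (fun G _ => intrinsicInterior_subset)) hclosed
  obtain ⟨G, hG, hmG⟩ := mem_iUnion₂.1 (hsub2 hm)
  obtain ⟨f, rfl⟩ := hG.1.2 ⟨v, hG.2.1⟩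
  have hsP : s ∈ P := hsu.2.2.subset (left_mem_segment ℝ s u)
  have hfm := hmG.2 v hv.1
  simp only [AffineMap.lineMap_apply, vsub_eq_sub, vadd_eq_add, map_add, map_smul, map_sub,
      smul_eq_mul] at hfm
  have i1 := hG.2.1.2 s hsP
  have i2 := hG.2.1.2 u hu.1
  have : f = 0 := hf f (by linarith) (by linarith)
  have htG : t ∈ {x ∈ P | ∀ y ∈ P, f y ≤ f x} := ⟨ht, fun y _ => by simp [this]⟩
  linarith [hG.2.2 t htG]
end
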